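/- Let F be any set of triangles in ℝ² such that the intersection of any two triangles of F is a common face of both. Then the restriction of the relation ≺ to F has an irreflexive transitive closure; equivalently, the transitive closure of ≺ on F is a strict partial order (there is no triangle Δ ∈ F related to itself by a chain Δ ≺ Δ' ≺ ⋯ ≺ Δ within F). -/

import Mathlib

open Set

noncomputable section

/-- A point of the integer lattice `ℤ² ⊆ ℝ²`. -/
def IsLatticePoint (p : ℝ × ℝ) : Prop := ∃ a b : ℤ, p = ((a : ℝ), (b : ℝ))

/-- A triangle: the convex hull of three affinely independent points of `ℝ²`. -/
def IsTriangle (Δ : Set (ℝ × ℝ)) : Prop :=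
  ∃ p q r : ℝ × ℝ, AffineIndependent ℝ ![p, q, r] ∧ Δ = convexHull ℝ {p, q, r}

/-- `F` is a face of the triangle `Δ`: the empty set, a vertex, an edge,
or the whole triangle. -/
def IsFaceOf (F Δ : Set (ℝ × ℝ)) : Prop :=
  ∃ p q r : ℝ × ℝ, AffineIndependent ℝ ![p, q, r] ∧ Δ = convexHull ℝ {p, q, r} ∧
    (F = ∅ ∨ F = {p} ∨ F = {q} ∨ F = {r} ∨
     F = segment ℝ p q ∨ F = segment ℝ q r ∨ F = segment ℝ p r ∨ F = Δ)

/-- The determinant of the two edge vectors of the triangle `pqr` emanating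
from `p`; its absolute value is twice the Euclidean area of the triangle. -/
def triDet (p q r : ℝ × ℝ) : ℝ :=
  (q.1 - p.1) * (r.2 - p.2) - (q.2 - p.2) * (r.1 - p.1)

/-- A unimodular triangle: a lattice triangle of area `1/2`. -/
def IsUnimodularTriangle (Δ : Set (ℝ × ℝ)) : Prop :=
  ∃ p q r : ℝ × ℝ, IsLatticePoint p ∧ IsLatticePoint q ∧ IsLatticePoint r ∧
    AffineIndependent ℝ ![p, q, r] ∧ Δ = convexHull ℝ {p, q, r} ∧
    |triDet p q r| = 1

/-- `T` is a unimodular triangulation of the region `P`. -/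
def IsUnimodularTriangulation (P : Set (ℝ × ℝ)) (T : Set (Set (ℝ × ℝ))) : Prop :=
  T.Finite ∧ (∀ Δ ∈ T, IsUnimodularTriangle Δ ∧ Δ ⊆ P) ∧ ⋃₀ T = P ∧
  ∀ Δ₁ ∈ T, ∀ Δ₂ ∈ T, IsFaceOf (Δ₁ ∩ Δ₂) Δ₁ ∧ IsFaceOf (Δ₁ ∩ Δ₂) Δ₂

/-- The number of unimodular triangulations of the region `P`. -/
def numTriangulations (P : Set (ℝ × ℝ)) : ℕ :=
  Set.ncard {T | IsUnimodularTriangulation P T}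

/-- `f m n` is the number of unimodular triangulations of `[0,m] × [0,n]`. -/
def f (m n : ℕ) : ℕ :=
  numTriangulations (Set.Icc (0, 0) ((m : ℝ), (n : ℝ)))

/-- `Δ₂` lies above `Δ₁` (written `Δ₁ ≺ Δ₂`). -/
def LiesAbove (Δ₁ Δ₂ : Set (ℝ × ℝ)) : Prop :=
  ∃ x y₁ y₂ : ℝ, (x, y₁) ∈ Δ₁ \ Δ₂ ∧ (x, y₂) ∈ Δ₂ \ Δ₁ ∧ y₁ < y₂

theorem mem_convexHull_triple_iff {E : Type*} [AddCommGroup E] [Module ℝ E] {p q r z : E} :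
    z ∈ convexHull ℝ {p, q, r} ↔
      ∃ a b c : ℝ, 0 ≤ a ∧ 0 ≤ b ∧ 0 ≤ c ∧ a + b + c = 1 ∧ a • p + b • q + c • r = z := by
  constructor
  · rw [convexHull_insert (by simp), convexHull_pair, convexJoin_singleton_left]
    simp only [mem_iUnion, exists_prop]
    rintro ⟨_, ⟨s, t, hs, ht, hst, rfl⟩, u, v, hu, hv, huv, rfl⟩
    refine ⟨u, v * s, v * t, hu, by positivity, by positivity, ?_, by module⟩
    linear_combination huv + v * hst
  · rintro ⟨a, b, c, ha, hb, hc, h, rfl⟩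
    have hconv := convex_convexHull ℝ ({p, q, r} : Set E)
    have hp := subset_convexHull ℝ ({p, q, r} : Set E) (show p ∈ _ by simp)
    have hq := subset_convexHull ℝ ({p, q, r} : Set E) (show q ∈ _ by simp)
    have hr := subset_convexHull ℝ ({p, q, r} : Set E) (show r ∈ _ by simp)
    have := hconv.sum_mem (t := Finset.univ) (w := ![a, b, c]) (z := ![p, q, r])
      (by simp [Fin.forall_fin_succ, ha, hb, hc]) (by simpa [Fin.sum_univ_three] using h)
      (by simp [Fin.forall_fin_succ, hp, hq, hr])
    simpa [Fin.sum_univ_three] using this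

theorem AffineIndependent.triple_weights_eq {E : Type*} [AddCommGroup E] [Module ℝ E]
    {p q r : E} (h : AffineIndependent ℝ ![p, q, r]) {a b c a' b' c' : ℝ}
    (hsum : a + b + c = a' + b' + c')
    (hcomb : a • p + b • q + c • r = a' • p + b' • q + c' • r) :
    a = a' ∧ b = b' ∧ c = c' := by
  have := h.eq_of_sum_eq_sum (s := Finset.univ) (w₁ := ![a, b, c]) (w₂ := ![a', b', c'])
    (by simpa [Fin.sum_univ_three] using hsum) (by simpa [Fin.sum_univ_three] using hcomb)
  exact ⟨this 0 (by simp), this 1 (by simp), this 2 (by simp)⟩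

theorem AffineIndependent.triple_rotate {E : Type*} [AddCommGroup E] [Module ℝ E]
    {p q r : E} (h : AffineIndependent ℝ ![p, q, r]) : AffineIndependent ℝ ![q, r, p] := by
  rw [affineIndependent_iff_not_collinear_set] at h ⊢
  rwa [show ({q, r, p} : Set E) = {p, q, r} by ext; simp; tauto]

theorem isExtreme_segment_convexHull_triple {E : Type*} [AddCommGroup E] [Module ℝ E]
    {p q r : E} (h : AffineIndependent ℝ ![p, q, r]) :
    IsExtreme ℝ (convexHull ℝ {p, q, r}) (segment ℝ p q) := by
  refine ⟨?_, ?_⟩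
  · rw [← convexHull_pair]
    exact convexHull_mono (by intro; simp; tauto)
  · rintro x hx y hy z ⟨a, b, ha, hb, hab, rfl⟩ ⟨s, t, hs, ht, hst, hz⟩
    obtain ⟨a₁, b₁, c₁, ha₁, hb₁, hc₁, h₁, rfl⟩ := mem_convexHull_triple_iff.1 hx
    obtain ⟨a₂, b₂, c₂, ha₂, hb₂, hc₂, h₂, rfl⟩ := mem_convexHull_triple_iff.1 hy
    obtain ⟨-, -, hc⟩ := h.triple_weights_eq (a := s * a₁ + t * a₂) (b := s * b₁ + t * b₂)
      (c := s * c₁ + t * c₂) (a' := a) (b' := b) (c' := 0)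
      (by linear_combination s * h₁ + t * h₂ + hst - hab)
      (by linear_combination (norm := module) hz)
    have hc₁' : c₁ = 0 := by
      by_contra hne
      have : 0 < c₁ := lt_of_le_of_ne hc₁ (Ne.symm hne)
      have : 0 < s * c₁ + t * c₂ := by positivity
      linarith
    subst hc₁'
    exact ⟨a₁, b₁, ha₁, hb₁, by linarith, by simp⟩

theorem isExtreme_singleton_convexHull_triple {E : Type*} [AddCommGroup E] [Module ℝ E]
    {p q r : E} (h : AffineIndependent ℝ ![p, q, r]) :
    IsExtreme ℝ (convexHull ℝ {p, q, r}) {p} := by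
  have hpq := isExtreme_segment_convexHull_triple h
  have hrp := isExtreme_segment_convexHull_triple h.triple_rotate.triple_rotate
  rw [show ({r, p, q} : Set E) = {p, q, r} by ext; simp; tauto] at hrp
  convert hpq.inter hrp using 1
  ext z
  constructor
  · rintro rfl
    exact ⟨left_mem_segment ℝ _ _, right_mem_segment ℝ _ _⟩
  · rintro ⟨⟨a, b, ha, hb, hab, rfl⟩, c, d, hc, hd, hcd, hz⟩
    obtain ⟨-, hb0, -⟩ := h.triple_weights_eq (a := a) (b := b) (c := 0) (a' := d) (b' := 0)
      (c' := c) (by linarith) (by linear_combination (norm := module) -hz)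
    subst hb0
    obtain rfl : a = 1 := by linarith
    simp

theorem IsFaceOf.isExtreme {G Δ : Set (ℝ × ℝ)} (h : IsFaceOf G Δ) : IsExtreme ℝ Δ G := by
  obtain ⟨p, q, r, hind, rfl, hG⟩ := h
  have hq : ({q, r, p} : Set (ℝ × ℝ)) = {p, q, r} := by ext; simp; tauto
  have hr : ({r, p, q} : Set (ℝ × ℝ)) = {p, q, r} := by ext; simp; tauto
  have iq := hind.triple_rotate
  have ir := iq.triple_rotate
  rcases hG with rfl | rfl | rfl | rfl | rfl | rfl | rfl | rfl
  · exact ⟨empty_subset _, by simp⟩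
  · exact isExtreme_singleton_convexHull_triple hind
  · exact hq ▸ isExtreme_singleton_convexHull_triple iq
  · exact hr ▸ isExtreme_singleton_convexHull_triple ir
  · exact isExtreme_segment_convexHull_triple hind
  · exact hq ▸ isExtreme_segment_convexHull_triple iq
  · rw [segment_symm]
    exact hr ▸ isExtreme_segment_convexHull_triple ir
  · exact IsExtreme.rfl

theorem IsTriangle.convex {Δ : Set (ℝ × ℝ)} (h : IsTriangle Δ) : Convex ℝ Δ := by
  obtain ⟨p, q, r, -, rfl⟩ := h
  exact convex_convexHull ℝ _

theorem IsTriangle.exists_forall_fst_le {Δ : Set (ℝ × ℝ)} (h : IsTriangle Δ) :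
    ∃ v ∈ Δ, ∀ w ∈ Δ, w.1 ≤ v.1 := by
  obtain ⟨p, q, r, -, rfl⟩ := h
  exact ((Set.toFinite {p, q, r}).isCompact_convexHull ℝ).exists_isMaxOn
    (convexHull_nonempty_iff.2 (by simp)) continuous_fst.continuousOn

/-- A convex set contains the point of the segment from `u` to `v` with first coordinate `x`. -/
theorem Convex.exists_mem_fst_eq {Δ : Set (ℝ × ℝ)} (h : Convex ℝ Δ) {u v : ℝ × ℝ} (hu : u ∈ Δ)
    (hv : v ∈ Δ) {x : ℝ} (hux : u.1 ≤ x) (hxv : x < v.1) :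
    (x, u.2 + (x - u.1) / (v.1 - u.1) * (v.2 - u.2)) ∈ Δ := by
  have hpos : 0 < v.1 - u.1 := by linarith
  convert h.add_smul_sub_mem hu hv (t := (x - u.1) / (v.1 - u.1))
    ⟨div_nonneg (by linarith) hpos.le, (div_le_one hpos).2 (by linarith)⟩ using 1
  ext
  · simp
    field_simp
    ring
  · simp

/-- A triangle is not contained in a non-vertical line. -/
theorem IsTriangle.exists_snd_ne {Δ : Set (ℝ × ℝ)} (h : IsTriangle Δ) (m c : ℝ) :
    ∃ w ∈ Δ, w.2 ≠ m * w.1 + c := by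
  obtain ⟨p, q, r, hind, rfl⟩ := h
  by_contra! hline
  refine affineIndependent_iff_not_collinear_set.1 hind
    ((collinear_iff_exists_forall_eq_smul_vadd _).2 ⟨(0, c), (1, m), fun w hw => ⟨w.1, ?_⟩⟩)
  have := hline w (subset_convexHull ℝ _ hw)
  ext
  · simp
  · simp [this, mul_comm]

/-- Over an interior point of its projection, a triangle has a nondegenerate vertical slice. -/
theorem IsTriangle.exists_lt_of_fst_lt {Δ : Set (ℝ × ℝ)} (h : IsTriangle Δ) {u v : ℝ × ℝ}
    (hu : u ∈ Δ) (hv : v ∈ Δ) {x : ℝ} (hux : u.1 < x) (hxv : x < v.1) :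
    ∃ y₁ y₂, (x, y₁) ∈ Δ ∧ (x, y₂) ∈ Δ ∧ y₁ < y₂ := by
  suffices ∃ y₁ y₂, (x, y₁) ∈ Δ ∧ (x, y₂) ∈ Δ ∧ y₁ ≠ y₂ by
    obtain ⟨y₁, y₂, h₁, h₂, hne⟩ := this
    rcases hne.lt_or_gt with hlt | hlt
    exacts [⟨y₁, y₂, h₁, h₂, hlt⟩, ⟨y₂, y₁, h₂, h₁, hlt⟩]
  have huv := h.convex.exists_mem_fst_eq hu hv hux.le hxv
  have hpos : 0 < v.1 - u.1 := by linarith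
  obtain ⟨w, hw, hne⟩ := h.exists_snd_ne ((v.2 - u.2) / (v.1 - u.1))
    (u.2 - (v.2 - u.2) / (v.1 - u.1) * u.1)
  rcases le_or_gt w.1 x with hwx | hwx
  · refine ⟨_, _, huv, h.convex.exists_mem_fst_eq hw hv hwx hxv, fun heq => hne ?_⟩
    have : 0 < v.1 - w.1 := by linarith
    have hvx : v.1 - x ≠ 0 := by linarith
    field_simp at heq ⊢
    apply mul_left_cancel₀ hvx
    linear_combination -heq
  · refine ⟨_, _, huv, h.convex.exists_mem_fst_eq hu hw hux.le hwx, fun heq => hne ?_⟩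
    have : 0 < w.1 - u.1 := by linarith
    have hvx : x - u.1 ≠ 0 := by linarith
    field_simp at heq ⊢
    apply mul_left_cancel₀ hvx
    linear_combination -heq

/-- If a convex set lies above another one at some abscissa and the intersection is extreme, then
it lies weakly above at every abscissa. -/
theorem LiesAbove.snd_le_snd {A B : Set (ℝ × ℝ)} (hA : Convex ℝ A)
    (hB : Convex ℝ B) (hext : IsExtreme ℝ A (A ∩ B)) (h : LiesAbove A B) {x a b : ℝ}
    (ha : (x, a) ∈ A) (hb : (x, b) ∈ B) : a ≤ b := by
  obtain ⟨x₀, a₀, b₀, ⟨ha₀, ha₀'⟩, ⟨hb₀, -⟩, h₀⟩ := h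
  by_contra! hlt
  have hpos : 0 < (a - b) + (b₀ - a₀) := by linarith
  set t := (b₀ - a₀) / ((a - b) + (b₀ - a₀))
  have ht0 : 0 < t := div_pos (by linarith) hpos
  have ht1 : t < 1 := (div_lt_one hpos).2 (by linarith)
  have hz : (1 - t) • ((x₀, a₀) : ℝ × ℝ) + t • (x, a) = (1 - t) • (x₀, b₀) + t • (x, b) := by
    ext
    · simp
    · have : t * ((a - b) + (b₀ - a₀)) = b₀ - a₀ := div_mul_cancel₀ _ hpos.ne'
      simp
      linear_combination this
  have hzB := hB hb₀ hb (sub_nonneg.2 ht1.le) ht0.le (sub_add_cancel 1 t)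
  rw [← hz] at hzB
  have hzo : (1 - t) • ((x₀, a₀) : ℝ × ℝ) + t • (x, a) ∈ openSegment ℝ (x₀, a₀) (x, a) :=
    ⟨1 - t, t, sub_pos.2 ht1, ht0, sub_add_cancel 1 t, rfl⟩
  exact ha₀' (hext.left_mem_of_mem_openSegment ha₀ ha
    ⟨hA.openSegment_subset ha₀ ha hzo, hzB⟩ hzo).2

/-- Transitivity of `LiesAbove` through a triangle whose projection ends first on the right. -/
theorem LiesAbove.trans_of_fst_le {A D B : Set (ℝ × ℝ)} (hA : Convex ℝ A) (hD : IsTriangle D)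
    (hB : Convex ℝ B) (hAD : LiesAbove A D) (hDB : LiesAbove D B)
    (wAD : ∀ ⦃x a d : ℝ⦄, (x, a) ∈ A → (x, d) ∈ D → a ≤ d)
    (wDB : ∀ ⦃x d b : ℝ⦄, (x, d) ∈ D → (x, b) ∈ B → d ≤ b)
    {u v w : ℝ × ℝ} (hu : u ∈ A) (hv : v ∈ D) (hw : w ∈ B) (hmax : ∀ z ∈ D, z.1 ≤ v.1)
    (hvu : v.1 ≤ u.1) (hvw : v.1 ≤ w.1) : LiesAbove A B := by
  obtain ⟨x₁, a₁, d₁, ⟨ha₁, ha₁'⟩, ⟨hd₁, hd₁'⟩, h₁⟩ := hAD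
  obtain ⟨x₂, d₂, b₂, ⟨hd₂, hd₂'⟩, ⟨hb₂, hb₂'⟩, h₂⟩ := hDB
  have hx₁ : x₁ ≤ v.1 := hmax _ hd₁
  have hx₂ : x₂ ≤ v.1 := hmax _ hd₂
  have slice : ∀ {C : Set (ℝ × ℝ)}, Convex ℝ C → ∀ {x y : ℝ} {z : ℝ × ℝ}, (x, y) ∈ C → z ∈ C →
      ∀ {x' : ℝ}, x ≤ x' → x' ≤ z.1 → ∃ y', (x', y') ∈ C := by
    intro C hC x y z hxy hz x' hxx' hx'z
    rcases hx'z.eq_or_lt with rfl | hlt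
    · exact ⟨z.2, hz⟩
    · exact ⟨_, hC.exists_mem_fst_eq hxy hz hxx' hlt⟩
  rcases hx₁.eq_or_lt with rfl | hlt₁
  · obtain ⟨c, hc⟩ := slice hB hb₂ hw hx₂ hvw
    have hdc := wDB hd₁ hc
    refine ⟨_, a₁, c, ⟨ha₁, fun h => ?_⟩, ⟨hc, fun h => ?_⟩, by linarith⟩
    · linarith [wDB hd₁ h]
    · obtain rfl : c = d₁ := le_antisymm (wAD h hd₁) hdc
      exact hd₁' h
  rcases hx₂.eq_or_lt with rfl | hlt₂
  · obtain ⟨a, ha⟩ := slice hA ha₁ hu hx₁ hvu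
    have had := wAD ha hd₂
    refine ⟨_, a, b₂, ⟨ha, fun h => ?_⟩, ⟨hb₂, fun h => ?_⟩, by linarith⟩
    · obtain rfl : a = d₂ := le_antisymm had (wDB hd₂ h)
      exact hd₂' h
    · linarith [wAD h hd₂]
  obtain ⟨x, hx, hxv⟩ := exists_between (max_lt hlt₁ hlt₂)
  obtain ⟨hxx₁, hxx₂⟩ := max_lt_iff.1 hx
  obtain ⟨d, d', hd, hd', hdd'⟩ := hD.exists_lt_of_fst_lt hd₁ hv hxx₁ hxv
  obtain ⟨a, ha⟩ := slice hA ha₁ hu hxx₁.le (hxv.le.trans hvu)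
  obtain ⟨b, hb⟩ := slice hB hb₂ hw hxx₂.le (hxv.le.trans hvw)
  refine ⟨x, a, b, ⟨ha, fun h => ?_⟩, ⟨hb, fun h => ?_⟩, ?_⟩
  · linarith [wAD ha hd, wDB hd' h]
  · linarith [wAD h hd, wDB hd' hb]
  · linarith [wAD ha hd, wDB hd' hb]

theorem Relation.TransGen.exists_finset {α : Type*} [DecidableEq α] {r : α → α → Prop} {a b : α}
    (h : Relation.TransGen r a b) :
    ∃ S : Finset α, Relation.TransGen (fun x y => x ∈ S ∧ y ∈ S ∧ r x y) a b := by
  induction h with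
  | @single b hab => exact ⟨{a, b}, .single (by simp [hab])⟩
  | @tail b c _ hbc ih =>
    obtain ⟨S, hS⟩ := ih
    refine ⟨insert b (insert c S),
      .tail (b := b) (Relation.TransGen.mono (fun x y h => ?_) _ _ hS) (by simp [hbc])⟩
    exact ⟨by simp [h.1], by simp [h.2.1], h.2.2⟩

/-- An irreflexive relation which is transitive through elements of locally minimal rank has an
irreflexive transitive closure. -/
theorem Relation.not_transGen_self_of_rank {α β : Type*} [LinearOrder β] {r : α → α → Prop}
    (ρ : α → β) (hirr : ∀ a, ¬ r a a)
    (htrans : ∀ a d b, r a d → r d b → ρ d ≤ ρ a → ρ d ≤ ρ b → r a b) (a : α) :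
    ¬ Relation.TransGen r a a := by
  classical
  intro ha
  obtain ⟨S, hS⟩ := ha.exists_finset
  clear ha
  induction S using Finset.strongInduction generalizing a with
  | H S ih =>
  have haS : a ∈ S := by
    obtain ⟨_, h, -⟩ := Relation.TransGen.head'_iff.1 hS
    exact h.1
  obtain ⟨d, hd, hmin⟩ := S.exists_min_image ρ ⟨a, haS⟩
  have bypass : ∀ x y, Relation.TransGen (fun x y => x ∈ S ∧ y ∈ S ∧ r x y) x y → x ≠ d →
      (y ≠ d → Relation.TransGen
        (fun x y => x ∈ S.erase d ∧ y ∈ S.erase d ∧ r x y) x y) ∧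
      (y = d → ∃ z ∈ S.erase d, r z d ∧ Relation.ReflTransGen
        (fun x y => x ∈ S.erase d ∧ y ∈ S.erase d ∧ r x y) x z) := by
    intro x y hxy hx
    induction hxy with
    | @single y h =>
      refine ⟨fun hy => .single ⟨?_, ?_, h.2.2⟩, ?_⟩
      · exact Finset.mem_erase.2 ⟨hx, h.1⟩
      · exact Finset.mem_erase.2 ⟨hy, h.2.1⟩
      · rintro rfl
        exact ⟨x, Finset.mem_erase.2 ⟨hx, h.1⟩, h.2.2, .refl⟩
    | @tail z y _ h ihz =>
      by_cases hz : z = d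
      · subst hz
        obtain ⟨e, he, hez, hxe⟩ := ihz.2 rfl
        refine ⟨fun hy => .tail' hxe ⟨he, Finset.mem_erase.2 ⟨hy, h.2.1⟩, ?_⟩, ?_⟩
        · exact htrans e z y hez h.2.2 (hmin _ (Finset.mem_of_mem_erase he)) (hmin _ h.2.1)
        · rintro rfl
          exact (hirr _ h.2.2).elim
      · have hz' := Finset.mem_erase.2 ⟨hz, h.1⟩
        refine ⟨fun hy => .tail (ihz.1 hz) ⟨hz', Finset.mem_erase.2 ⟨hy, h.2.1⟩, h.2.2⟩, ?_⟩
        rintro rfl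
        exact ⟨z, hz', h.2.2, (ihz.1 hz).to_reflTransGen⟩
  have ih' := ih (S.erase d) (Finset.erase_ssubset hd)
  by_cases had : a = d
  · subst had
    obtain ⟨c, hac, hca⟩ := Relation.TransGen.head'_iff.1 hS
    have hne : c ≠ a := by
      rintro rfl
      exact hirr _ hac.2.2
    rcases Relation.reflTransGen_iff_eq_or_transGen.1 hca with heq | hca
    · exact hne heq.symm
    · obtain ⟨e, he, hea, hce⟩ := (bypass c a hca hne).2 rfl
      exact ih' c (.tail' hce ⟨he, Finset.mem_erase.2 ⟨hne, hac.2.1⟩,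
        htrans e a c hea hac.2.2 (hmin _ (Finset.mem_of_mem_erase he)) (hmin _ hac.2.1)⟩)
  · exact ih' a ((bypass a a hS had).1 had)

/-- For a family `F` of triangles in `ℝ²`, any two of which intersect in a
common face of both, the transitive closure of `≺` restricted to `F` is
irreflexive, i.e., it is a strict partial order. -/
theorem transGen_liesAbove_irrefl (F : Set (Set (ℝ × ℝ)))
    (htri : ∀ Δ ∈ F, IsTriangle Δ)
    (hface : ∀ Δ₁ ∈ F, ∀ Δ₂ ∈ F, Δ₁ ≠ Δ₂ →
      IsFaceOf (Δ₁ ∩ Δ₂) Δ₁ ∧ IsFaceOf (Δ₁ ∩ Δ₂) Δ₂) :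
    ∀ Δ : Set (ℝ × ℝ),
      ¬ Relation.TransGen (fun A B => A ∈ F ∧ B ∈ F ∧ LiesAbove A B) Δ Δ := by
  have hirr : ∀ A, ¬ LiesAbove A A := fun A ⟨_, _, _, h, _⟩ => h.2 h.1
  have hle : ∀ {A B : Set (ℝ × ℝ)}, A ∈ F → B ∈ F → LiesAbove A B →
      ∀ ⦃x a b : ℝ⦄, (x, a) ∈ A → (x, b) ∈ B → a ≤ b := by
    intro A B hA hB h x a b ha hb
    have hne : A ≠ B := by
      rintro rfl
      exact hirr _ h
    exact h.snd_le_snd (htri A hA).convex (htri B hB).convex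
      (hface A hA B hB hne).1.isExtreme ha hb
  have hright : ∀ Δ : Set (ℝ × ℝ), ∃ v : ℝ × ℝ, Δ ∈ F → v ∈ Δ ∧ ∀ w ∈ Δ, w.1 ≤ v.1 := by
    intro Δ
    by_cases hΔ : Δ ∈ F
    · obtain ⟨v, hv⟩ := (htri Δ hΔ).exists_forall_fst_le
      exact ⟨v, fun _ => hv⟩
    · exact ⟨0, fun h => (hΔ h).elim⟩
  choose v hv using hright
  refine Relation.not_transGen_self_of_rank (fun Δ => (v Δ).1) (fun A h => hirr A h.2.2) ?_
  rintro A D B ⟨hA, hD, hAD⟩ ⟨-, hB, hDB⟩ hDA hDB'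
  exact ⟨hA, hB, hAD.trans_of_fst_le (htri A hA).convex (htri D hD) (htri B hB).convex hDB
    (hle hA hD hAD) (hle hD hB hDB) (hv A hA).1 (hv D hD).1 (hv B hB).1 (hv D hD).2 hDA hDB'⟩
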